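/- Cancellation of the scale connection for conformal coupling (Dirac's case k = 6): let n = 4, let (g, φ) be a Weylian metric on U with Weylian scalar curvature R, and let β : U → ℝ be smooth. With the scale covariant derivative D_λβ = ∂_λβ − φ_λ β (weight −1) one has the exact density identity √|det g| (β² R + 6 g^{λκ} D_λβ D_κβ) = √|det g| (β² _gR + 6 g^{λκ} ∂_λβ ∂_κβ) − 6 ∂_λ( √|det g| β² φ^λ ) on U; hence the Weyl geometric conformally coupled Lagrangian density differs from its Riemannian counterpart only by a divergence. -/

import Mathlib

noncomputable section

open scoped BigOperators

/-- Partial derivative `∂_μ f` of a real-valued function on `ℝⁿ`. -/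
def pd {n : ℕ} (μ : Fin n) (f : (Fin n → ℝ) → ℝ) : (Fin n → ℝ) → ℝ :=
  fun x => fderiv ℝ f x (Pi.single μ 1)

/-- Partial derivative `∂_μ f` of a complex-valued function on `ℝⁿ`. -/
def pdC {n : ℕ} (μ : Fin n) (f : (Fin n → ℝ) → ℂ) : (Fin n → ℝ) → ℂ :=
  fun x => fderiv ℝ f x (Pi.single μ 1)

/-- Christoffel symbols `_gΓ^μ_{νλ}` of the metric `g` (with inverse `ginv`). -/
def christoffel {n : ℕ} (g ginv : (Fin n → ℝ) → Fin n → Fin n → ℝ)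
    (μ ν lam : Fin n) (x : Fin n → ℝ) : ℝ :=
  (1/2) * ∑ κ, ginv x μ κ *
    (pd ν (fun y => g y κ lam) x + pd lam (fun y => g y κ ν) x - pd κ (fun y => g y ν lam) x)

/-- Weylian affine connection `Γ^μ_{νλ}` of the Weylian metric `(g, φ)`:
`Γ^μ_{νλ} = _gΓ^μ_{νλ} + δ^μ_ν φ_λ + δ^μ_λ φ_ν − g_{νλ} φ^μ`. -/
def weylConn {n : ℕ} (g ginv : (Fin n → ℝ) → Fin n → Fin n → ℝ)
    (φ : (Fin n → ℝ) → Fin n → ℝ) (μ ν lam : Fin n) (x : Fin n → ℝ) : ℝ :=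
  christoffel g ginv μ ν lam x
    + (if ν = μ then φ x lam else 0) + (if lam = μ then φ x ν else 0)
    - g x ν lam * ∑ κ, ginv x μ κ * φ x κ

/-- Curvature tensor `R^μ_{νλκ}` of a family of connection coefficients `Γ`. -/
def curvOf {n : ℕ} (Γ : (Fin n → ℝ) → Fin n → Fin n → Fin n → ℝ)
    (μ ν lam κ : Fin n) (x : Fin n → ℝ) : ℝ :=
  pd lam (fun y => Γ y μ ν κ) x - pd κ (fun y => Γ y μ ν lam) x
    + ∑ σ, Γ x μ lam σ * Γ x σ ν κ - ∑ σ, Γ x μ κ σ * Γ x σ ν lam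

/-- Ricci tensor `R_{νκ} = R^μ_{νμκ}`. -/
def ricciOf {n : ℕ} (Γ : (Fin n → ℝ) → Fin n → Fin n → Fin n → ℝ)
    (ν κ : Fin n) (x : Fin n → ℝ) : ℝ :=
  ∑ μ, curvOf Γ μ ν μ κ x

/-- Scalar curvature `R = g^{νκ} R_{νκ}`. -/
def scalarOf {n : ℕ} (ginv : (Fin n → ℝ) → Fin n → Fin n → ℝ)
    (Γ : (Fin n → ℝ) → Fin n → Fin n → Fin n → ℝ) (x : Fin n → ℝ) : ℝ :=
  ∑ ν, ∑ κ, ginv x ν κ * ricciOf Γ ν κ x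

/-- Volume factor `√|det g|`. -/
def volFac {n : ℕ} (g : (Fin n → ℝ) → Fin n → Fin n → ℝ) (x : Fin n → ℝ) : ℝ :=
  Real.sqrt |Matrix.det (Matrix.of (g x))|

/-- Laplace–Beltrami operator `Δ_g f = (1/√|det g|) ∂_μ ( √|det g| g^{μν} ∂_ν f )`. -/
def laplaceBeltrami {n : ℕ} (g ginv : (Fin n → ℝ) → Fin n → Fin n → ℝ)
    (f : (Fin n → ℝ) → ℝ) (x : Fin n → ℝ) : ℝ :=
  (volFac g x)⁻¹ * ∑ μ, pd μ (fun y => volFac g y * ∑ ν, ginv y μ ν * pd ν f y) x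

/-- Minkowski matrix `η = diag(1, −1, −1, −1)`. -/
def etaM : Fin 4 → Fin 4 → ℝ :=
  fun μ ν => if μ = ν then (if μ = 0 then 1 else -1) else 0

/-- The coefficients `Γ^μ_{νλ} + δ^μ_ν φ_λ + δ^μ_λ φ_ν − g_{νλ} V^μ` at a point. -/
def weylShift {n : ℕ} (Γ : Fin n → Fin n → Fin n → ℝ) (g : Fin n → Fin n → ℝ)
    (φ V : Fin n → ℝ) (μ ν lam : Fin n) : ℝ :=
  Γ μ ν lam + (if ν = μ then φ lam else 0) + (if lam = μ then φ ν else 0) - g ν lam * V μ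

section PointwiseAlgebra

variable {n : ℕ} (Γ : Fin n → Fin n → Fin n → ℝ) (g : Fin n → Fin n → ℝ) (φ V : Fin n → ℝ)

theorem sum_mul_weylShift_upper (a : Fin n → ℝ) (ν κ : Fin n) :
    ∑ σ, a σ * weylShift Γ g φ V σ ν κ
      = ∑ σ, a σ * Γ σ ν κ + a ν * φ κ + a κ * φ ν - g ν κ * ∑ σ, a σ * V σ := by
  simp only [weylShift, mul_sub, mul_add, Finset.sum_sub_distrib, Finset.sum_add_distrib,
    mul_ite, mul_zero, Finset.sum_ite_eq, Finset.mem_univ, if_true, Finset.mul_sum]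
  congr 1
  exact Finset.sum_congr rfl fun _ _ => by ring

variable {Γ g φ V}

theorem sum_weylShift_trace (hV : ∀ ν, ∑ μ, g ν μ * V μ = φ ν) (ν : Fin n) :
    ∑ μ, weylShift Γ g φ V μ ν μ = ∑ μ, Γ μ ν μ + n * φ ν := by
  simp [weylShift, Finset.sum_sub_distrib, Finset.sum_add_distrib, hV]
  ring

theorem weylShift_symm (hΓ : ∀ μ ν lam, Γ μ ν lam = Γ μ lam ν) (hg : ∀ μ ν, g μ ν = g ν μ)
    (μ ν lam : Fin n) : weylShift Γ g φ V μ ν lam = weylShift Γ g φ V μ lam ν := by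
  simp only [weylShift, hΓ μ ν lam, hg ν lam]
  ring

theorem sum_mul_weylShift_lower (hV : ∀ ν, ∑ μ, g ν μ * V μ = φ ν) (σ ν : Fin n) :
    ∑ μ, V μ * weylShift Γ g φ V σ ν μ
      = ∑ μ, V μ * Γ σ ν μ + if ν = σ then ∑ μ, φ μ * V μ else 0 := by
  have h : ∑ μ, V μ * (g ν μ * V σ) = φ ν * V σ := by
    rw [← hV, Finset.sum_mul]
    exact Finset.sum_congr rfl fun _ _ => by ring
  simp only [weylShift, mul_sub, mul_add, Finset.sum_sub_distrib, Finset.sum_add_distrib, h,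
    mul_ite, mul_zero, Finset.sum_ite_eq', Finset.mem_univ, if_true]
  split_ifs
  · simp only [mul_comm (V _) (φ _)]; ring
  · simp; ring

/-- Contraction of `weylShift` with an arbitrary tensor in its first and last slots. -/
theorem sum_sum_mul_weylShift (T : Fin n → Fin n → ℝ) (ν : Fin n) :
    ∑ μ, ∑ σ, T μ σ * weylShift Γ g φ V σ ν μ
      = ∑ μ, ∑ σ, T μ σ * Γ σ ν μ + ∑ μ, T μ ν * φ μ + (∑ μ, T μ μ) * φ ν
        - ∑ μ, g ν μ * ∑ σ, T μ σ * V σ := by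
  simp only [sum_mul_weylShift_upper, Finset.sum_sub_distrib, Finset.sum_add_distrib,
    Finset.sum_mul]

theorem sum_sum_weylShift_mul_weylShift (hΓ : ∀ μ ν lam, Γ μ ν lam = Γ μ lam ν)
    (hg : ∀ μ ν, g μ ν = g ν μ) (hV : ∀ ν, ∑ μ, g ν μ * V μ = φ ν) (ν κ : Fin n) :
    ∑ μ, ∑ σ, weylShift Γ g φ V μ κ σ * weylShift Γ g φ V σ ν μ
      = ∑ μ, ∑ σ, Γ μ κ σ * Γ σ ν μ + 2 * ∑ σ, φ σ * Γ σ ν κ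
        + (∑ μ, Γ μ μ κ) * φ ν + (∑ μ, Γ μ μ ν) * φ κ
        - ∑ μ, g ν μ * ∑ σ, V σ * Γ μ κ σ - ∑ μ, g κ μ * ∑ σ, V σ * Γ μ ν σ
        + (n + 2) * (φ ν * φ κ) - 2 * (g ν κ * ∑ σ, φ σ * V σ) := by
  rw [sum_sum_mul_weylShift (fun μ σ => weylShift Γ g φ V μ κ σ)]
  have h1 : ∑ μ, ∑ σ, weylShift Γ g φ V μ κ σ * Γ σ ν μ
      = ∑ μ, ∑ σ, Γ μ κ σ * Γ σ ν μ + ∑ σ, φ σ * Γ σ ν κ + φ κ * (∑ μ, Γ μ ν μ)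
        - ∑ μ, g κ μ * ∑ σ, V σ * Γ μ ν σ := by
    rw [Finset.sum_comm]
    simp only [mul_comm (weylShift _ _ _ _ _ _ _)]
    rw [sum_sum_mul_weylShift (fun μ σ => Γ μ ν σ)]
    rw [Finset.sum_comm (f := fun μ σ => Γ μ κ σ * Γ σ ν μ)]
    have hΓΓ : ∑ μ, ∑ σ, Γ μ ν σ * Γ σ κ μ = ∑ μ, ∑ σ, Γ σ κ μ * Γ μ ν σ := by
      simp only [mul_comm]
    simp only [hΓΓ, mul_comm (Γ _ _ _) (V _), mul_comm (Γ _ _ _) (φ _)]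
    ring
  have h2 : ∑ μ, weylShift Γ g φ V μ κ ν * φ μ
      = ∑ σ, φ σ * Γ σ ν κ + 2 * (φ ν * φ κ) - g ν κ * ∑ σ, φ σ * V σ := by
    simp only [mul_comm (weylShift _ _ _ _ _ _ _) (φ _)]
    rw [sum_mul_weylShift_upper]
    rw [hg κ ν, Finset.sum_congr rfl fun σ _ => by rw [hΓ σ κ ν]]
    ring
  have h3 : ∑ μ, g ν μ * ∑ σ, weylShift Γ g φ V μ κ σ * V σ
      = ∑ μ, g ν μ * ∑ σ, V σ * Γ μ κ σ + g ν κ * ∑ σ, φ σ * V σ := by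
    simp only [mul_comm (weylShift _ _ _ _ _ _ _) (V _), sum_mul_weylShift_lower hV]
    simp [mul_add, Finset.sum_add_distrib, mul_comm]
  rw [h1, h2, h3, sum_weylShift_trace hV]
  simp only [fun μ => hΓ μ μ κ, fun μ => hΓ μ μ ν]
  ring

theorem sum_weylShift_curvature_quadratic (hΓ : ∀ μ ν lam, Γ μ ν lam = Γ μ lam ν)
    (hg : ∀ μ ν, g μ ν = g ν μ) (hV : ∀ ν, ∑ μ, g ν μ * V μ = φ ν) (ν κ : Fin n) :
    ∑ μ, (∑ σ, weylShift Γ g φ V μ μ σ * weylShift Γ g φ V σ ν κ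
        - ∑ σ, weylShift Γ g φ V μ κ σ * weylShift Γ g φ V σ ν μ)
      = ∑ μ, (∑ σ, Γ μ μ σ * Γ σ ν κ - ∑ σ, Γ μ κ σ * Γ σ ν μ)
        + (n - 2) * ∑ σ, φ σ * Γ σ ν κ - g ν κ * ∑ σ, (∑ μ, Γ μ μ σ) * V σ
        + ∑ μ, g ν μ * ∑ σ, V σ * Γ μ κ σ + ∑ μ, g κ μ * ∑ σ, V σ * Γ μ ν σ
        + (n - 2) * (φ ν * φ κ - g ν κ * ∑ σ, φ σ * V σ) := by
  have h1 : ∑ μ, ∑ σ, weylShift Γ g φ V μ μ σ * weylShift Γ g φ V σ ν κ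
      = ∑ σ, (∑ μ, Γ μ μ σ + n * φ σ) * weylShift Γ g φ V σ ν κ := by
    rw [Finset.sum_comm]
    refine Finset.sum_congr rfl fun σ _ => ?_
    rw [← Finset.sum_mul]
    simp only [weylShift_symm hΓ hg _ _ σ, sum_weylShift_trace hV, fun μ => hΓ μ μ σ]
  have h2 : ∑ μ, ∑ σ, Γ μ μ σ * Γ σ ν κ = ∑ σ, (∑ μ, Γ μ μ σ) * Γ σ ν κ := by
    rw [Finset.sum_comm]
    simp only [Finset.sum_mul]
  rw [Finset.sum_sub_distrib, Finset.sum_sub_distrib, h1, h2, sum_mul_weylShift_upper,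
    sum_sum_weylShift_mul_weylShift hΓ hg hV]
  simp only [add_mul, Finset.sum_add_distrib, mul_assoc, ← Finset.mul_sum]
  ring

end PointwiseAlgebra

section PartialDerivatives

variable {n : ℕ} {f h : (Fin n → ℝ) → ℝ} {x : Fin n → ℝ}

theorem pd_congr (hfh : f =ᶠ[nhds x] h) (μ : Fin n) : pd μ f x = pd μ h x := by
  simp only [pd, hfh.fderiv_eq]

theorem pd_add (hf : DifferentiableAt ℝ f x) (hh : DifferentiableAt ℝ h x) (μ : Fin n) :
    pd μ (fun y => f y + h y) x = pd μ f x + pd μ h x := by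
  simp [pd, fderiv_fun_add hf hh]

theorem pd_sub (hf : DifferentiableAt ℝ f x) (hh : DifferentiableAt ℝ h x) (μ : Fin n) :
    pd μ (fun y => f y - h y) x = pd μ f x - pd μ h x := by
  simp [pd, fderiv_fun_sub hf hh]

theorem pd_mul (hf : DifferentiableAt ℝ f x) (hh : DifferentiableAt ℝ h x) (μ : Fin n) :
    pd μ (fun y => f y * h y) x = pd μ f x * h x + f x * pd μ h x := by
  simp [pd, fderiv_fun_mul hf hh]
  ring

theorem pd_sum {ι : Type*} {s : Finset ι} {F : ι → (Fin n → ℝ) → ℝ}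
    (hF : ∀ i ∈ s, DifferentiableAt ℝ (F i) x) (μ : Fin n) :
    pd μ (fun y => ∑ i ∈ s, F i y) x = ∑ i ∈ s, pd μ (F i) x := by
  simp [pd, fderiv_fun_sum hF]

theorem pd_ite (p : Prop) [Decidable p] (μ : Fin n) :
    pd μ (fun y => if p then f y else 0) x = if p then pd μ f x else 0 := by
  split_ifs <;> simp [pd]

theorem differentiableAt_ite (p : Prop) [Decidable p] (hf : DifferentiableAt ℝ f x) :
    DifferentiableAt ℝ (fun y => if p then f y else 0) x := by
  split_ifs
  · exact hf
  · exact differentiableAt_const 0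

theorem differentiableAt_pd (hf : ContDiffAt ℝ (⊤ : ℕ∞) f x) (μ : Fin n) :
    DifferentiableAt ℝ (pd μ f) x :=
  (((contDiffAt_infty.1 hf 2).fderiv_right (m := 1)
    (by norm_num)).differentiableAt (by norm_num)).clm_apply (differentiableAt_const _)

end PartialDerivatives

/-- Near `x`, `g` is a smooth metric with smooth inverse `ginv`. -/
structure IsMetricAt {n : ℕ} (g ginv : (Fin n → ℝ) → Fin n → Fin n → ℝ) (x : Fin n → ℝ) :
    Prop where
  contDiffAt : ∀ μ ν, ContDiffAt ℝ (⊤ : ℕ∞) (fun y => g y μ ν) x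
  contDiffAt_inv : ∀ μ ν, ContDiffAt ℝ (⊤ : ℕ∞) (fun y => ginv y μ ν) x
  symm : ∀ᶠ y in nhds x, ∀ μ ν, g y μ ν = g y ν μ
  mul_inv : ∀ᶠ y in nhds x, ∀ μ ν, ∑ κ, g y μ κ * ginv y κ ν = if μ = ν then (1 : ℝ) else 0

namespace IsMetricAt

variable {n : ℕ} {g ginv : (Fin n → ℝ) → Fin n → Fin n → ℝ} {x : Fin n → ℝ}
  {φ : (Fin n → ℝ) → Fin n → ℝ}

theorem differentiableAt (hm : IsMetricAt g ginv x) (μ ν : Fin n) :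
    DifferentiableAt ℝ (fun y => g y μ ν) x :=
  (hm.contDiffAt μ ν).differentiableAt (by simp)

theorem differentiableAt_inv (hm : IsMetricAt g ginv x) (μ ν : Fin n) :
    DifferentiableAt ℝ (fun y => ginv y μ ν) x :=
  (hm.contDiffAt_inv μ ν).differentiableAt (by simp)

theorem of_mul_of_inv (hm : IsMetricAt g ginv x) :
    Matrix.of (g x) * Matrix.of (ginv x) = 1 := by
  ext μ ν
  simp [Matrix.mul_apply, Matrix.one_apply, hm.mul_inv.self_of_nhds μ ν]

theorem inv_symm (hm : IsMetricAt g ginv x) (μ ν : Fin n) : ginv x μ ν = ginv x ν μ := by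
  have h1 := hm.of_mul_of_inv
  have hg : (Matrix.of (g x)).transpose = Matrix.of (g x) := by
    ext i j
    exact hm.symm.self_of_nhds j i
  have h2 : (Matrix.of (ginv x)).transpose * Matrix.of (g x) = 1 := by
    rw [← hg, ← Matrix.transpose_mul, h1, Matrix.transpose_one]
  have h3 := left_inv_eq_right_inv h2 h1
  exact congrFun (congrFun h3 ν) μ

theorem inv_mul (hm : IsMetricAt g ginv x) (μ ν : Fin n) :
    ∑ κ, ginv x μ κ * g x κ ν = if μ = ν then (1 : ℝ) else 0 := by
  have h : Matrix.of (ginv x) * Matrix.of (g x) = 1 := mul_eq_one_comm.mp hm.of_mul_of_inv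
  replace h := congrFun (congrFun h μ) ν
  simpa [Matrix.mul_apply, Matrix.one_apply] using h

theorem pd_symm (hm : IsMetricAt g ginv x) (ρ μ ν : Fin n) :
    pd ρ (fun y => g y μ ν) x = pd ρ (fun y => g y ν μ) x :=
  pd_congr (hm.symm.mono fun _ hy => hy μ ν) ρ

theorem christoffel_symm (hm : IsMetricAt g ginv x) (μ ν lam : Fin n) :
    christoffel g ginv μ ν lam x = christoffel g ginv μ lam ν x := by
  simp only [christoffel]
  congr 1
  refine Finset.sum_congr rfl fun κ _ => ?_
  rw [hm.pd_symm κ ν lam]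
  ring

theorem differentiableAt_christoffel (hm : IsMetricAt g ginv x) (μ ν lam : Fin n) :
    DifferentiableAt ℝ (christoffel g ginv μ ν lam) x := by
  refine DifferentiableAt.const_mul (DifferentiableAt.fun_sum fun κ _ => ?_) _
  exact (hm.differentiableAt_inv μ κ).mul (((differentiableAt_pd (hm.contDiffAt κ lam) ν).add
    (differentiableAt_pd (hm.contDiffAt κ ν) lam)).sub (differentiableAt_pd (hm.contDiffAt ν lam) κ))

theorem sum_mul_christoffel (hm : IsMetricAt g ginv x) (ρ ν lam : Fin n) :
    ∑ σ, g x ρ σ * christoffel g ginv σ ν lam x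
      = (1 / 2) * (pd ν (fun y => g y ρ lam) x + pd lam (fun y => g y ρ ν) x
          - pd ρ (fun y => g y ν lam) x) := by
  set D : Fin n → ℝ := fun κ => pd ν (fun y => g y κ lam) x + pd lam (fun y => g y κ ν) x
          - pd κ (fun y => g y ν lam) x
  calc ∑ σ, g x ρ σ * christoffel g ginv σ ν lam x
      = (1 / 2) * ∑ κ, (∑ σ, g x ρ σ * ginv x σ κ) * D κ := by
        simp only [christoffel, Finset.mul_sum, Finset.sum_mul]
        rw [Finset.sum_comm]
        exact Finset.sum_congr rfl fun _ _ => Finset.sum_congr rfl fun _ _ => by ring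
    _ = _ := by simp [hm.mul_inv.self_of_nhds, D]

/-- Metric compatibility of the Levi-Civita connection. -/
theorem pd_eq_sum_christoffel (hm : IsMetricAt g ginv x) (μ ν κ : Fin n) :
    pd μ (fun y => g y ν κ) x = ∑ σ, g x ν σ * christoffel g ginv σ μ κ x
      + ∑ σ, g x κ σ * christoffel g ginv σ μ ν x := by
  rw [hm.sum_mul_christoffel, hm.sum_mul_christoffel, hm.pd_symm μ κ ν, hm.pd_symm κ ν μ,
    hm.pd_symm ν κ μ]
  ring

theorem sum_inv_mul_pd (hm : IsMetricAt g ginv x) (μ : Fin n) :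
    ∑ ν, ∑ κ, ginv x ν κ * pd μ (fun y => g y ν κ) x
      = 2 * ∑ σ, christoffel g ginv σ σ μ x := by
  have h : ∀ F : Fin n → Fin n → ℝ,
      ∑ ν, ∑ κ, ginv x ν κ * ∑ σ, g x κ σ * F σ ν = ∑ σ, F σ σ := fun F => by
    refine Finset.sum_congr rfl fun ν _ => ?_
    simp only [Finset.mul_sum, ← mul_assoc]
    rw [Finset.sum_comm]
    simp [← Finset.sum_mul, hm.inv_mul]
  have h' : ∀ F : Fin n → Fin n → ℝ,
      ∑ ν, ∑ κ, ginv x ν κ * ∑ σ, g x ν σ * F σ κ = ∑ σ, F σ σ := fun F => by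
    rw [← h F, Finset.sum_comm]
    exact Finset.sum_congr rfl fun κ _ => Finset.sum_congr rfl fun ν _ => by
      rw [hm.inv_symm ν κ]
  simp only [hm.pd_eq_sum_christoffel, mul_add, Finset.sum_add_distrib]
  rw [h fun σ ν => christoffel g ginv σ μ ν x, h' fun σ κ => christoffel g ginv σ μ κ x]
  simp only [fun σ => hm.christoffel_symm σ μ σ]
  ring

theorem sum_mul_raise (hm : IsMetricAt g ginv x) (a : Fin n → ℝ) (ν : Fin n) :
    ∑ μ, g x ν μ * ∑ κ, ginv x μ κ * a κ = a ν := by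
  simp only [Finset.mul_sum, ← mul_assoc]
  rw [Finset.sum_comm]
  simp [← Finset.sum_mul, hm.mul_inv.self_of_nhds]

theorem eventually_sum_mul_raise (hm : IsMetricAt g ginv x) (ν : Fin n) :
    (fun y => ∑ μ, g y ν μ * ∑ κ, ginv y μ κ * φ y κ) =ᶠ[nhds x] fun y => φ y ν := by
  filter_upwards [hm.mul_inv] with y hy
  simp only [Finset.mul_sum, ← mul_assoc]
  rw [Finset.sum_comm]
  simp [← Finset.sum_mul, hy]

theorem differentiableAt_raise (hm : IsMetricAt g ginv x)
    (hφ : ∀ μ, DifferentiableAt ℝ (fun y => φ y μ) x) (μ : Fin n) :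
    DifferentiableAt ℝ (fun y => ∑ κ, ginv y μ κ * φ y κ) x :=
  DifferentiableAt.fun_sum fun κ _ => (hm.differentiableAt_inv μ κ).mul (hφ κ)

theorem det_ne_zero (hm : IsMetricAt g ginv x) : (Matrix.of (g x)).det ≠ 0 :=
  (Matrix.isUnit_det_of_right_inverse hm.of_mul_of_inv).ne_zero

theorem hasFDerivAt_det (hm : IsMetricAt g ginv x) :
    ∃ L : (Fin n → ℝ) →L[ℝ] ℝ, HasFDerivAt (fun y => (Matrix.of (g y)).det) L x ∧
      ∀ μ, L (Pi.single μ 1)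
        = (Matrix.of (g x)).det * (2 * ∑ σ, christoffel g ginv σ σ μ x) := by
  let D : ContinuousMultilinearMap ℝ (fun _ : Fin n => Fin n → ℝ) ℝ :=
    ⟨Matrix.detRowAlternating.toMultilinearMap, Continuous.matrix_det continuous_id⟩
  have hg : HasFDerivAt g (fderiv ℝ g x) x :=
    (differentiableAt_pi.2 fun μ => differentiableAt_pi.2 fun ν =>
      hm.differentiableAt μ ν).hasFDerivAt
  refine ⟨_, (D.hasFDerivAt (g x)).comp x hg, fun μ => ?_⟩
  have hcomp : ∀ ν κ, fderiv ℝ g x (Pi.single μ 1) ν κ = pd μ (fun y => g y ν κ) x := fun ν κ => by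
    have := ((hasFDerivAt_pi'.1 (hasFDerivAt_pi'.1 hg ν)) κ).fderiv
    simp only [pd, this]
    rfl
  have hadj : (Matrix.of (g x)).adjugate = (Matrix.of (g x)).det • Matrix.of (ginv x) := by
    have h := congrArg (· * Matrix.of (ginv x)) (Matrix.adjugate_mul (Matrix.of (g x)))
    simpa [mul_assoc, hm.of_mul_of_inv] using h
  rw [← hm.sum_inv_mul_pd μ, Finset.sum_comm, Finset.mul_sum]
  simp only [ContinuousLinearMap.comp_apply, ContinuousMultilinearMap.linearDeriv_apply]
  refine Finset.sum_congr rfl fun ν _ => ?_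
  change ((Matrix.of (g x)).updateRow ν (fderiv ℝ g x (Pi.single μ 1) ν)).det = _
  rw [← Matrix.cramer_transpose_apply, Matrix.cramer_eq_adjugate_mulVec, ← Matrix.adjugate_transpose,
    hadj]
  simp only [Matrix.mulVec, dotProduct, Matrix.transpose_apply, Matrix.smul_apply, hcomp,
    Matrix.of_apply, smul_eq_mul, Finset.mul_sum, mul_assoc]
  exact Finset.sum_congr rfl fun κ _ => by rw [hm.pd_symm μ ν κ]

theorem differentiableAt_volFac (hm : IsMetricAt g ginv x) : DifferentiableAt ℝ (volFac g) x := by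
  obtain ⟨L, hL, -⟩ := hm.hasFDerivAt_det
  exact (hL.differentiableAt.abs hm.det_ne_zero).sqrt (abs_ne_zero.2 hm.det_ne_zero)

theorem pd_volFac (hm : IsMetricAt g ginv x) (μ : Fin n) :
    pd μ (volFac g) x = volFac g x * ∑ σ, christoffel g ginv σ σ μ x := by
  obtain ⟨L, hL, hLμ⟩ := hm.hasFDerivAt_det
  have hsq : (fun y => volFac g y * volFac g y) = fun y => |(Matrix.of (g y)).det| := by
    funext y
    exact Real.mul_self_sqrt (abs_nonneg _)
  have h4 : (fun y => |(Matrix.of (g y)).det| * |(Matrix.of (g y)).det|)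
      = fun y => (Matrix.of (g y)).det * (Matrix.of (g y)).det := by
    funext y
    exact abs_mul_abs_self _
  have hd : DifferentiableAt ℝ (fun y => |(Matrix.of (g y)).det|) x :=
    hL.differentiableAt.abs hm.det_ne_zero
  have e1 := congrArg (fun f => pd μ f x) hsq
  have e2 := congrArg (fun f => pd μ f x) h4
  simp only [pd_mul hm.differentiableAt_volFac hm.differentiableAt_volFac] at e1
  simp only [pd_mul hd hd, pd_mul hL.differentiableAt hL.differentiableAt] at e2
  have hL' : pd μ (fun y => (Matrix.of (g y)).det) x
      = (Matrix.of (g x)).det * (2 * ∑ σ, christoffel g ginv σ σ μ x) := by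
    rw [← hLμ, pd, hL.fderiv]
  have hv0 : volFac g x ≠ 0 := (Real.sqrt_pos.2 (abs_pos.2 hm.det_ne_zero)).ne'
  have ha0 : |(Matrix.of (g x)).det| ≠ 0 := abs_ne_zero.2 hm.det_ne_zero
  rw [hL'] at e2
  have e3 : pd μ (fun y => |(Matrix.of (g y)).det|) x
      = |(Matrix.of (g x)).det| * (2 * ∑ σ, christoffel g ginv σ σ μ x) := by
    apply mul_left_cancel₀ ha0
    linear_combination e2 / 2 - 2 * (∑ σ, christoffel g ginv σ σ μ x) * congrFun h4 x
  rw [e3] at e1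
  apply mul_left_cancel₀ hv0
  linear_combination e1 / 2 - (∑ σ, christoffel g ginv σ σ μ x) * congrFun hsq x

/-- The trace of `∂φ` in terms of the Christoffel symbols and the divergence of the dual of `φ`. -/
theorem sum_inv_mul_pd_covector (hm : IsMetricAt g ginv x)
    (hφ : ∀ μ, DifferentiableAt ℝ (fun y => φ y μ) x) :
    ∑ ν, ∑ κ, ginv x ν κ * pd κ (fun y => φ y ν) x
      = ∑ ν, ∑ κ, ginv x ν κ * ∑ σ, φ x σ * christoffel g ginv σ ν κ x
        + ∑ μ, pd μ (fun y => ∑ κ, ginv y μ κ * φ y κ) x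
        + ∑ σ, (∑ μ, christoffel g ginv μ μ σ x) * ∑ κ, ginv x σ κ * φ x κ := by
  set V : (Fin n → ℝ) → Fin n → ℝ := fun y μ => ∑ κ, ginv y μ κ * φ y κ
  have hVd : ∀ μ, DifferentiableAt ℝ (fun y => V y μ) x := hm.differentiableAt_raise hφ
  have hVφ : ∀ ν, ∑ μ, g x ν μ * V x μ = φ x ν := hm.sum_mul_raise (φ x)
  have hpd : ∀ κ ν, pd κ (fun y => φ y ν) x
      = ∑ σ, φ x σ * christoffel g ginv σ ν κ x
        + ∑ σ, g x ν σ * (∑ μ, christoffel g ginv σ κ μ x * V x μ + pd κ (fun y => V y σ) x) := by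
    intro κ ν
    rw [← pd_congr (hm.eventually_sum_mul_raise ν) κ]
    change pd κ (fun y => ∑ μ, g y ν μ * V y μ) x = _
    rw [pd_sum (F := fun μ y => g y ν μ * V y μ)
      fun μ _ => (hm.differentiableAt ν μ).fun_mul (hVd μ)]
    simp only [pd_mul (hm.differentiableAt ν _) (hVd _), Finset.sum_add_distrib, mul_add,
      hm.pd_eq_sum_christoffel, add_mul, Finset.sum_mul, ← hVφ, Finset.mul_sum]
    have e1 : ∑ i, ∑ j, g x ν j * christoffel g ginv j κ i x * V x i
        = ∑ i, ∑ j, g x ν i * (christoffel g ginv i κ j x * V x j) := by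
      rw [Finset.sum_comm]
      simp only [mul_assoc]
    have e2 : ∑ i, ∑ j, g x i j * christoffel g ginv j κ ν x * V x i
        = ∑ i, ∑ j, g x i j * V x j * christoffel g ginv i ν κ x := by
      rw [Finset.sum_comm]
      refine Finset.sum_congr rfl fun i _ => Finset.sum_congr rfl fun j _ => ?_
      rw [hm.symm.self_of_nhds j i, hm.christoffel_symm i κ ν]
      ring
    rw [e1, e2]
    ring
  have hc : ∀ F : Fin n → Fin n → ℝ,
      ∑ ν, ∑ κ, ginv x ν κ * ∑ σ, g x ν σ * F σ κ = ∑ σ, F σ σ := fun F => by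
    rw [Finset.sum_comm]
    refine Finset.sum_congr rfl fun κ _ => ?_
    simp only [Finset.mul_sum, ← mul_assoc]
    rw [Finset.sum_comm]
    simp only [hm.inv_symm _ κ, ← Finset.sum_mul, hm.inv_mul]
    simp
  rw [Finset.sum_congr rfl fun ν _ => Finset.sum_congr rfl fun κ _ => by rw [hpd, mul_add]]
  simp only [Finset.sum_add_distrib]
  rw [hc fun σ κ => ∑ μ, christoffel g ginv σ κ μ x * V x μ + pd κ (fun y => V y σ) x,
    Finset.sum_add_distrib]
  have htrace : ∑ σ, (∑ μ, christoffel g ginv μ μ σ x) * V x σ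
      = ∑ σ, ∑ μ, christoffel g ginv σ σ μ x * V x μ := by
    simp only [Finset.sum_mul]
    exact Finset.sum_comm
  change _ = _ + ∑ μ, pd μ (fun y => V y μ) x
    + ∑ σ, (∑ μ, christoffel g ginv μ μ σ x) * V x σ
  rw [htrace]
  ring

theorem pd_weylConn (hm : IsMetricAt g ginv x)
    (hφ : ∀ μ, DifferentiableAt ℝ (fun y => φ y μ) x) (ρ μ ν lam : Fin n) :
    pd ρ (fun y => weylConn g ginv φ μ ν lam y) x
      = pd ρ (fun y => christoffel g ginv μ ν lam y) x
        + (if ν = μ then pd ρ (fun y => φ y lam) x else 0)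
        + (if lam = μ then pd ρ (fun y => φ y ν) x else 0)
        - pd ρ (fun y => g y ν lam * ∑ κ, ginv y μ κ * φ y κ) x := by
  have h1 := hm.differentiableAt_christoffel μ ν lam
  have h2 := differentiableAt_ite (ν = μ) (hφ lam)
  have h3 := differentiableAt_ite (lam = μ) (hφ ν)
  have h4 := (hm.differentiableAt ν lam).fun_mul (hm.differentiableAt_raise hφ μ)
  simp only [weylConn]
  rw [pd_sub ((h1.fun_add h2).fun_add h3) h4, pd_add (h1.fun_add h2) h3, pd_add h1 h2, pd_ite,
    pd_ite]

theorem ricciOf_weylConn (hm : IsMetricAt g ginv x)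
    (hφ : ∀ μ, DifferentiableAt ℝ (fun y => φ y μ) x) (ν κ : Fin n) :
    ricciOf (fun y a b c => weylConn g ginv φ a b c y) ν κ x
      = ricciOf (fun y a b c => christoffel g ginv a b c y) ν κ x
        + pd ν (fun y => φ y κ) x + (1 - n) * pd κ (fun y => φ y ν) x
        + (n - 2) * ∑ σ, φ x σ * christoffel g ginv σ ν κ x
        - g x ν κ * (∑ μ, pd μ (fun y => ∑ κ, ginv y μ κ * φ y κ) x
          + ∑ σ, (∑ μ, christoffel g ginv μ μ σ x) * ∑ κ, ginv x σ κ * φ x κ)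
        + (n - 2) * (φ x ν * φ x κ - g x ν κ * ∑ σ, φ x σ * ∑ κ, ginv x σ κ * φ x κ) := by
  set V : (Fin n → ℝ) → Fin n → ℝ := fun y μ => ∑ κ, ginv y μ κ * φ y κ
  have hVd : ∀ μ, DifferentiableAt ℝ (fun y => V y μ) x := hm.differentiableAt_raise hφ
  have hVφ : ∀ ν, ∑ μ, g x ν μ * V x μ = φ x ν := hm.sum_mul_raise (φ x)
  have hquad := sum_weylShift_curvature_quadratic (Γ := fun a b c => christoffel g ginv a b c x)
    hm.christoffel_symm hm.symm.self_of_nhds hVφ ν κ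
  have hshift : ∀ a b c, weylShift (fun a b c => christoffel g ginv a b c x) (g x) (φ x) (V x) a b c
      = weylConn g ginv φ a b c x := fun _ _ _ => rfl
  simp only [hshift] at hquad
  have hpd1 : ∑ μ, pd μ (fun y => weylConn g ginv φ μ ν κ y) x
      = ∑ μ, pd μ (fun y => christoffel g ginv μ ν κ y) x
        + pd ν (fun y => φ y κ) x + pd κ (fun y => φ y ν) x
        - ∑ μ, g x ν μ * ∑ σ, V x σ * christoffel g ginv μ κ σ x
        - ∑ μ, g x κ μ * ∑ σ, V x σ * christoffel g ginv μ ν σ x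
        - g x ν κ * ∑ μ, pd μ (fun y => V y μ) x := by
    have hgV : ∀ μ, pd μ (fun y => g y ν κ * ∑ κ, ginv y μ κ * φ y κ) x
        = ∑ σ, g x ν σ * (V x μ * christoffel g ginv σ κ μ x)
          + ∑ σ, g x κ σ * (V x μ * christoffel g ginv σ ν μ x)
          + g x ν κ * pd μ (fun y => V y μ) x := fun μ => by
      rw [pd_mul (hm.differentiableAt ν κ) (hVd μ), hm.pd_eq_sum_christoffel, add_mul,
        Finset.sum_mul, Finset.sum_mul]
      congr 2 <;> refine Finset.sum_congr rfl fun σ _ => ?_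
      · rw [hm.christoffel_symm σ μ κ]; ring
      · rw [hm.christoffel_symm σ μ ν]; ring
    simp only [hm.pd_weylConn hφ, hgV, Finset.sum_sub_distrib, Finset.sum_add_distrib,
      Finset.sum_ite_eq, Finset.mem_univ, if_true]
    have hswap : ∀ F : Fin n → Fin n → ℝ, ∀ a : Fin n → ℝ,
        ∑ μ, ∑ σ, a σ * (V x μ * F σ μ) = ∑ μ, a μ * ∑ σ, V x σ * F μ σ := fun F a => by
      rw [Finset.sum_comm]
      simp only [Finset.mul_sum]
    rw [hswap (fun σ μ => christoffel g ginv σ κ μ x), hswap (fun σ μ => christoffel g ginv σ ν μ x),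
      ← Finset.mul_sum]
    ring
  have hpd2 : ∑ μ, pd κ (fun y => weylConn g ginv φ μ ν μ y) x
      = ∑ μ, pd κ (fun y => christoffel g ginv μ ν μ y) x + n * pd κ (fun y => φ y ν) x := by
    have h := pd_sum (s := Finset.univ) (F := fun μ y => g y ν μ * V y μ)
      (fun μ _ => (hm.differentiableAt ν μ).fun_mul (hVd μ)) κ
    rw [pd_congr (hm.eventually_sum_mul_raise ν) κ] at h
    simp only [hm.pd_weylConn hφ, Finset.sum_sub_distrib, Finset.sum_add_distrib]
    rw [← h]
    simp
    ring
  simp only [ricciOf, curvOf, add_sub_assoc, Finset.sum_add_distrib] at hquad ⊢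
  simp only [Finset.sum_sub_distrib] at hquad hpd1 hpd2 ⊢
  linear_combination hquad + hpd1 - hpd2

theorem scalarOf_weylConn (hm : IsMetricAt g ginv x)
    (hφ : ∀ μ, DifferentiableAt ℝ (fun y => φ y μ) x) :
    scalarOf ginv (fun y a b c => weylConn g ginv φ a b c y) x
      = scalarOf ginv (fun y a b c => christoffel g ginv a b c y) x
        - 2 * (n - 1) * (∑ μ, pd μ (fun y => ∑ κ, ginv y μ κ * φ y κ) x
          + ∑ σ, (∑ μ, christoffel g ginv μ μ σ x) * ∑ κ, ginv x σ κ * φ x κ)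
        - (n - 1) * (n - 2) * ∑ σ, φ x σ * ∑ κ, ginv x σ κ * φ x κ := by
  have hA := hm.sum_inv_mul_pd_covector hφ
  have hA' : ∑ ν, ∑ κ, ginv x ν κ * pd ν (fun y => φ y κ) x
      = ∑ ν, ∑ κ, ginv x ν κ * pd κ (fun y => φ y ν) x := by
    rw [Finset.sum_comm]
    exact Finset.sum_congr rfl fun κ _ => Finset.sum_congr rfl fun ν _ => by rw [hm.inv_symm]
  have hg : ∑ ν, ∑ κ, ginv x ν κ * g x ν κ = n := by
    have : ∀ ν, ∑ κ, ginv x ν κ * g x ν κ = 1 := fun ν => by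
      simpa [hm.symm.self_of_nhds _ ν] using hm.inv_mul ν ν
    simp [this]
  have hφφ : ∑ ν, ∑ κ, ginv x ν κ * (φ x ν * φ x κ) = ∑ σ, φ x σ * ∑ κ, ginv x σ κ * φ x κ := by
    simp only [Finset.mul_sum]
    exact Finset.sum_congr rfl fun _ _ => Finset.sum_congr rfl fun _ _ => by ring
  simp only [scalarOf, hm.ricciOf_weylConn hφ]
  generalize (∑ μ, pd μ (fun y => ∑ κ, ginv y μ κ * φ y κ) x) = d at *
  generalize (∑ σ, (∑ μ, christoffel g ginv μ μ σ x) * ∑ κ, ginv x σ κ * φ x κ) = l at *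
  generalize (∑ σ, φ x σ * ∑ κ, ginv x σ κ * φ x κ) = q at *
  have key : ∀ r p p' t G f : Fin n → Fin n → ℝ,
      ∑ ν, ∑ κ, ginv x ν κ * (r ν κ + p ν κ + (1 - n) * p' ν κ + (n - 2) * t ν κ - G ν κ * (d + l)
        + (n - 2) * (f ν κ - G ν κ * q))
      = ∑ ν, ∑ κ, ginv x ν κ * r ν κ + ∑ ν, ∑ κ, ginv x ν κ * p ν κ
        + (1 - n) * ∑ ν, ∑ κ, ginv x ν κ * p' ν κ + (n - 2) * ∑ ν, ∑ κ, ginv x ν κ * t ν κ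
        - (∑ ν, ∑ κ, ginv x ν κ * G ν κ) * (d + l + (n - 2) * q)
        + (n - 2) * ∑ ν, ∑ κ, ginv x ν κ * f ν κ := fun r p p' t G f => by
    simp only [Finset.mul_sum, Finset.sum_mul, ← Finset.sum_add_distrib, ← Finset.sum_sub_distrib]
    exact Finset.sum_congr rfl fun _ _ => Finset.sum_congr rfl fun _ _ => by ring
  rw [key, hA', hg, hφφ]
  linear_combination (2 - n : ℝ) * hA

/-- The divergence formula `∂_λ(√|det g| V^λ) = √|det g| ∇_λ V^λ`, for `V = f W`. -/
theorem sum_pd_volFac_mul (hm : IsMetricAt g ginv x) {f : (Fin n → ℝ) → ℝ}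
    {W : (Fin n → ℝ) → Fin n → ℝ} (hf : DifferentiableAt ℝ f x)
    (hW : ∀ μ, DifferentiableAt ℝ (fun y => W y μ) x) :
    ∑ μ, pd μ (fun y => volFac g y * f y * W y μ) x
      = volFac g x * (∑ μ, pd μ f x * W x μ
          + f x * (∑ μ, pd μ (fun y => W y μ) x
            + ∑ σ, (∑ μ, christoffel g ginv μ μ σ x) * W x σ)) := by
  have hv := hm.differentiableAt_volFac
  simp only [pd_mul (hv.fun_mul hf) (hW _), pd_mul hv hf, hm.pd_volFac]
  rw [← Finset.sum_add_distrib, Finset.mul_sum, ← Finset.sum_add_distrib, Finset.mul_sum]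
  exact Finset.sum_congr rfl fun μ _ => by ring

end IsMetricAt

/-- Cancellation of the scale connection for conformal coupling (Dirac's
case `k = 6`), in dimension `n = 4`: with `D_λβ = ∂_λβ − φ_λ β`,
`√|det g| (β² R + 6 g^{λκ} D_λβ D_κβ)
  = √|det g| (β² _gR + 6 g^{λκ} ∂_λβ ∂_κβ) − 6 ∂_λ( √|det g| β² φ^λ )` on `U`. -/
theorem weyl_conformal_coupling_cancellation
    (U : Set (Fin 4 → ℝ)) (hU : IsOpen U) (hUne : U.Nonempty)
    (g ginv : (Fin 4 → ℝ) → Fin 4 → Fin 4 → ℝ)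
    (φ : (Fin 4 → ℝ) → Fin 4 → ℝ)
    (hg : ∀ μ ν, ContDiffOn ℝ (⊤ : ℕ∞) (fun x => g x μ ν) U)
    (hginv : ∀ μ ν, ContDiffOn ℝ (⊤ : ℕ∞) (fun x => ginv x μ ν) U)
    (hsym : ∀ x ∈ U, ∀ μ ν, g x μ ν = g x ν μ)
    (hinv : ∀ x ∈ U, ∀ μ ν, ∑ κ, g x μ κ * ginv x κ ν = if μ = ν then (1:ℝ) else 0)
    (hφ : ∀ μ, ContDiffOn ℝ (⊤ : ℕ∞) (fun x => φ x μ) U)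
    (β : (Fin 4 → ℝ) → ℝ) (hβ : ContDiffOn ℝ (⊤ : ℕ∞) β U) :
    ∀ x ∈ U,
      volFac g x * ((β x) ^ 2 * scalarOf ginv (fun y a b c => weylConn g ginv φ a b c y) x
            + 6 * ∑ lam, ∑ κ, ginv x lam κ
                * (pd lam β x - φ x lam * β x) * (pd κ β x - φ x κ * β x))
        = volFac g x * ((β x) ^ 2 * scalarOf ginv (fun y a b c => christoffel g ginv a b c y) x
              + 6 * ∑ lam, ∑ κ, ginv x lam κ * pd lam β x * pd κ β x)
          - 6 * ∑ lam, pd lam (fun y => volFac g y * (β y) ^ 2 * ∑ κ, ginv y lam κ * φ y κ) x := by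
  intro x hx
  have hUx : U ∈ nhds x := hU.mem_nhds hx
  have hm : IsMetricAt g ginv x :=
    ⟨fun μ ν => (hg μ ν).contDiffAt hUx, fun μ ν => (hginv μ ν).contDiffAt hUx,
      Filter.mem_of_superset hUx hsym, Filter.mem_of_superset hUx hinv⟩
  have hφd : ∀ μ, DifferentiableAt ℝ (fun y => φ y μ) x := fun μ =>
    ((hφ μ).contDiffAt hUx).differentiableAt (by simp)
  have hβd : DifferentiableAt ℝ β x := (hβ.contDiffAt hUx).differentiableAt (by simp)
  have hβ2 : ∀ μ, pd μ (fun y => β y ^ 2) x = 2 * β x * pd μ β x := fun μ => by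
    simp only [pow_two, pd_mul hβd hβd]
    ring
  rw [hm.scalarOf_weylConn hφd,
    hm.sum_pd_volFac_mul (f := fun y => β y ^ 2) (W := fun y lam => ∑ κ, ginv y lam κ * φ y κ)
      (hβd.pow 2) (hm.differentiableAt_raise hφd)]
  have hcross : ∑ lam, ∑ κ, ginv x lam κ * φ x lam * pd κ β x
      = ∑ lam, pd lam β x * ∑ κ, ginv x lam κ * φ x κ := by
    rw [Finset.sum_comm]
    simp only [Finset.mul_sum]
    exact Finset.sum_congr rfl fun lam _ => Finset.sum_congr rfl fun κ _ => by
      rw [hm.inv_symm]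
      ring
  have hsq : ∑ lam, ∑ κ, ginv x lam κ * (pd lam β x - φ x lam * β x) * (pd κ β x - φ x κ * β x)
      = ∑ lam, ∑ κ, ginv x lam κ * pd lam β x * pd κ β x
        - 2 * β x * ∑ lam, pd lam β x * ∑ κ, ginv x lam κ * φ x κ
        + β x ^ 2 * ∑ lam, φ x lam * ∑ κ, ginv x lam κ * φ x κ := by
    rw [two_mul, add_mul]
    nth_rewrite 1 [← hcross]
    simp only [Finset.mul_sum, ← Finset.sum_add_distrib, ← Finset.sum_sub_distrib]
    exact Finset.sum_congr rfl fun _ _ => Finset.sum_congr rfl fun _ _ => by ring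
  have hgrad : ∑ μ, pd μ (fun y => β y ^ 2) x * ∑ κ, ginv x μ κ * φ x κ
      = 2 * β x * ∑ lam, pd lam β x * ∑ κ, ginv x lam κ * φ x κ := by
    simp only [hβ2, Finset.mul_sum, mul_assoc]
  rw [hsq, hgrad]
  push_cast
  ring
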